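/- Let K ⊂ ℝⁿ be a closed convex cone with nonempty interior, f : ℝⁿ → ℝ K-monotone with |f| < C, and suppose the boundary of the epigraph of f is (after rotation) a Lipschitz graph with constant L. Then the total variation of f over the ball B(0,R) ⊂ ℝⁿ satisfies TV_{B(0,R)}(f) ≤ α(n) (√(R² + C²))ⁿ √(1 + L²), where α(n) is the volume of the n-dimensional unit ball. -/

import Mathlib

open Metric Set MeasureTheory RealInnerProductSpace

/-- Euclidean inner product on `ℝⁿ × ℝ`. -/
noncomputable def pInner {n : ℕ} (v w : EuclideanSpace ℝ (Fin n) × ℝ) : ℝ :=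
  ⟪v.1, w.1⟫ + v.2 * w.2

/-- Euclidean norm on `ℝⁿ × ℝ`. -/
noncomputable def pNorm {n : ℕ} (v : EuclideanSpace ℝ (Fin n) × ℝ) : ℝ :=
  Real.sqrt (‖v.1‖ ^ 2 + v.2 ^ 2)

theorem Real.mem_and_notMem_of_frontier_subset_singleton {T : Set ℝ} {C : ℝ}
    (hTC : Ici C ⊆ T) (hTC' : ∀ t ≤ -C, t ∉ T) {g : ℝ} (hg : frontier T ⊆ {g}) (t : ℝ) :
    (g < t → t ∈ T) ∧ (t < g → t ∉ T) := by
  have hcov : ∀ {s : Set ℝ}, g ∉ s → s ⊆ interior T ∪ interior Tᶜ := by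
    intro s hs x hx
    by_contra h
    rw [mem_union, not_or, interior_compl, mem_compl_iff, not_not] at h
    exact hs (mem_singleton_iff.1 (hg ⟨h.2, h.1⟩) ▸ hx)
  have hdisj : Disjoint (interior T) (interior Tᶜ) :=
    disjoint_compl_right.mono interior_subset interior_subset
  constructor
  · intro ht
    refine interior_subset (isPreconnected_Ioi.subset_left_of_subset_union isOpen_interior
      isOpen_interior hdisj (hcov (self_notMem_Ioi (a := g))) ?_ ht)
    refine ⟨max g C + 1, by simp only [mem_Ioi]; linarith [le_max_left g C], ?_⟩
    exact interior_mono hTC (by simp only [interior_Ici, mem_Ioi]; linarith [le_max_right g C])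
  · intro ht
    refine interior_subset (isPreconnected_Iio.subset_right_of_subset_union isOpen_interior
      isOpen_interior hdisj (hcov (self_notMem_Iio (a := g))) ?_ ht)
    refine ⟨min g (-C) - 1, by simp only [mem_Iio]; linarith [min_le_left g (-C)], ?_⟩
    exact interior_mono (s := Iic (-C)) hTC'
      (by simp only [interior_Iic, mem_Iio]; linarith [min_le_right g (-C)])

theorem Real.exists_mem_frontier_abs_le {T : Set ℝ} {C : ℝ}
    (hTC : Ici C ⊆ T) (hTC' : ∀ t ≤ -C, t ∉ T) : ∃ t ∈ frontier T, |t| ≤ C := by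
  have hne : (frontier T).Nonempty :=
    nonempty_frontier_iff.2 ⟨⟨C, hTC self_mem_Ici⟩, fun h => hTC' (-C) le_rfl (h ▸ mem_univ _)⟩
  obtain ⟨t, ht⟩ := hne
  refine ⟨t, ht, abs_le.2 ⟨?_, ?_⟩⟩
  · by_contra! h
    have : t ∈ interior Tᶜ := interior_mono (s := Iic (-C)) hTC' (by simpa using h)
    rw [interior_compl] at this
    exact this ht.1
  · by_contra! h
    exact ht.2 (interior_mono hTC (by simpa using h))

section

variable {V : Type*} [NormedAddCommGroup V] [InnerProductSpace ℝ V]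

/-- A covector whose graph is an `L`-Lipschitz hyperplane with respect to the unit direction
`(b, a)` has norm at most `|a| √(1 + L²)`. -/
theorem norm_le_of_forall_inner_add_sq_le {a L : ℝ} {b p : V} (ha : a ≠ 0)
    (hab : ‖b‖ ^ 2 + a ^ 2 = 1)
    (hp : ∀ h : V, (⟪h, b⟫ + ⟪p, h⟫ / a) ^ 2 ≤ L ^ 2 * (‖h‖ ^ 2 - ⟪h, b⟫ ^ 2)) :
    ‖p‖ ≤ |a| * √(1 + L ^ 2) := by
  set m : V := a⁻¹ • p + b with hm
  set c : ℝ := ⟪m, b⟫ with hc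
  have hpm : p = a • (m - b) := by simp [hm, smul_smul, ha]
  have hbb : ⟪b, b⟫ = 1 - a ^ 2 := by rw [real_inner_self_eq_norm_sq]; linarith
  have h1 : ∀ h : V, ⟪h, b⟫ + ⟪p, h⟫ / a = ⟪m, h⟫ := by
    intro h
    rw [hm, inner_add_left, real_inner_smul_left, real_inner_comm h b]; ring
  have key := hp (m + (c / a ^ 2) • b)
  rw [h1] at key
  have e1 : ⟪m, m + (c / a ^ 2) • b⟫ = ‖m‖ ^ 2 + c ^ 2 / a ^ 2 := by
    rw [inner_add_right, real_inner_smul_right, real_inner_self_eq_norm_sq, ← hc]; ring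
  have e2 : ⟪m + (c / a ^ 2) • b, b⟫ = c / a ^ 2 := by
    rw [inner_add_left, real_inner_smul_left, hbb, ← hc]; field_simp; ring
  have e3 : ‖m + (c / a ^ 2) • b‖ ^ 2 = ‖m‖ ^ 2 + 2 * c ^ 2 / a ^ 2
      + (c / a ^ 2) ^ 2 * (1 - a ^ 2) := by
    rw [norm_add_sq_real, real_inner_smul_right, ← hc, norm_smul, mul_pow, Real.norm_eq_abs,
      sq_abs, ← real_inner_self_eq_norm_sq b, hbb]; ring
  rw [e1, e2, e3] at key
  have e4 : ‖m‖ ^ 2 + 2 * c ^ 2 / a ^ 2 + (c / a ^ 2) ^ 2 * (1 - a ^ 2) - (c / a ^ 2) ^ 2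
      = ‖m‖ ^ 2 + c ^ 2 / a ^ 2 := by field_simp; ring
  rw [e4] at key
  set N := ‖m‖ ^ 2 + c ^ 2 / a ^ 2 with hN
  have hN0 : 0 ≤ N := by positivity
  have hNL : N ≤ L ^ 2 := by
    rcases hN0.eq_or_lt with h | h
    · rw [← h]; positivity
    · nlinarith
  have hmb : ‖m - b‖ ^ 2 ≤ 1 + L ^ 2 := by
    rw [norm_sub_sq_real, ← hc]
    have : N - 2 * c - a ^ 2 = ‖m‖ ^ 2 - 2 * c + c ^ 2 / a ^ 2 - a ^ 2 := by rw [hN]; ring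
    have h2 : (c / a + a) ^ 2 = c ^ 2 / a ^ 2 + 2 * c + a ^ 2 := by field_simp; ring
    nlinarith [sq_nonneg (c / a + a)]
  rw [hpm, norm_smul, Real.norm_eq_abs]
  exact mul_le_mul_of_nonneg_left (Real.le_sqrt_of_sq_le hmb) (abs_nonneg a)

variable [FiniteDimensional ℝ V] [MeasurableSpace V] [BorelSpace V]

/-- Volume of the ellipsoid of points whose projection orthogonal to the unit vector `(b, a)` of
`V × ℝ` has norm less than `ρ`. -/
theorem volume_setOf_norm_sq_sub_inner_sq_lt {a ρ : ℝ} {b : V} (ha : a ≠ 0)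
    (hab : ‖b‖ ^ 2 + a ^ 2 = 1) (hρ : 0 < ρ) :
    volume {x : V | ‖x‖ ^ 2 - ⟪x, b⟫ ^ 2 < ρ ^ 2} =
      ENNReal.ofReal (|a|⁻¹ * ρ ^ Module.finrank ℝ V) * volume (ball (0 : V) 1) := by
  have ha0 : 0 < |a| := abs_pos.2 ha
  have hbb : ‖b‖ ^ 2 = (1 - |a|) * (1 + |a|) := by
    have := sq_abs a
    nlinarith
  set c : ℝ := -(1 + |a|)⁻¹ with hc
  have hc1 : c * (1 + |a|) = -1 := by rw [hc]; field_simp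
  set S : V →ₗ[ℝ] V := LinearMap.transvection (innerₛₗ ℝ b) (c • b) with hS
  have hSx : ∀ x, S x = x + ⟪b, x⟫ • c • b := fun x => by
    simp [hS, LinearMap.transvection.apply]
  have hdet : LinearMap.det S = |a| := by
    rw [hS, LinearMap.transvection.det]
    simp only [innerₛₗ_apply_apply, real_inner_smul_right, real_inner_self_eq_norm_sq, hbb]
    linear_combination (1 - |a|) * hc1
  have hset : {x : V | ‖x‖ ^ 2 - ⟪x, b⟫ ^ 2 < ρ ^ 2} = S ⁻¹' ball 0 ρ := by
    ext x
    have : ‖S x‖ ^ 2 = ‖x‖ ^ 2 - ⟪x, b⟫ ^ 2 := by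
      rw [hSx, norm_add_sq_real, real_inner_smul_right, real_inner_smul_right, norm_smul,
        norm_smul, mul_pow, mul_pow, hbb, real_inner_comm x b]
      simp only [Real.norm_eq_abs, sq_abs]
      linear_combination (⟪x, b⟫ ^ 2 * (c * (1 - |a|) + 1)) * hc1
    rw [mem_ofPred_eq, ← this, mem_preimage, mem_ball_zero_iff,
      sq_lt_sq₀ (norm_nonneg _) hρ.le]
  rw [hset, Measure.addHaar_preimage_linearMap _ (by rw [hdet]; exact ha0.ne'), hdet,
    Measure.addHaar_ball_of_pos _ _ hρ, ← mul_assoc, abs_inv, abs_abs,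
    ENNReal.ofReal_mul (by positivity)]

end

/-- The map sending `(s, y)` to the point at height `s` above the graph of `G`, in coordinates
sheared by `w`. -/
def shear {V : Type*} [AddCommGroup V] [Module ℝ V] (G : V → ℝ) (w : V) (p : ℝ × V) : ℝ × V :=
  (p.1 + G p.2, p.2 + (p.1 + G p.2) • w)

theorem shear_mem_iff {V : Type*} [AddCommGroup V] [Module ℝ V] (G : V → ℝ) (w : V) (p : ℝ × V) :
    G ((shear G w p).2 - (shear G w p).1 • w) ≤ (shear G w p).1 ↔ 0 ≤ p.1 := by
  simp [shear]

section

variable {V : Type*} [NormedAddCommGroup V] [InnerProductSpace ℝ V] [FiniteDimensional ℝ V]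
  [MeasurableSpace V] [BorelSpace V]

theorem measurePreserving_shear {G : V → ℝ} (hG : Continuous G) (w : V) :
    MeasurePreserving (shear G w) (volume : Measure (ℝ × V)) volume := by
  have h1 : MeasurePreserving (fun p : V × ℝ => (p.1, p.2 + G p.1))
      (volume.prod volume) (volume.prod volume) :=
    (MeasurePreserving.id volume).skew_product (g := fun y s => s + G y)
      (by unfold Function.uncurry; fun_prop)
      (Filter.Eventually.of_forall fun y => map_add_right_eq_self _ _)
  have h2 : MeasurePreserving (fun p : ℝ × V => (p.1, p.2 + p.1 • w))
      (volume.prod volume) (volume.prod volume) :=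
    (MeasurePreserving.id volume).skew_product (g := fun t y => y + t • w)
      (by unfold Function.uncurry; fun_prop)
      (Filter.Eventually.of_forall fun t => map_add_right_eq_self _ _)
  exact h2.comp (Measure.measurePreserving_swap.comp (h1.comp Measure.measurePreserving_swap))

theorem ae_ae_ne_of_continuous {G : V → ℝ} (hG : Continuous G) (w : V) :
    ∀ᵐ x : V, ∀ᵐ t : ℝ, G (x - t • w) ≠ t := by
  have hmeas : MeasurableSet {p : ℝ × V | G (p.2 - p.1 • w) ≠ p.1} :=
    (isClosed_eq (by fun_prop) (by fun_prop)).isOpen_compl.measurableSet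
  rw [← Measure.ae_ae_comm (p := fun (t : ℝ) (x : V) => G (x - t • w) ≠ t) hmeas]
  refine Measure.ae_ae_of_ae_prod (p := fun z : ℝ × V => G (z.2 - z.1 • w) ≠ z.1) ?_
  change ∀ᵐ z : ℝ × V, _
  rw [← (measurePreserving_shear hG w).map_eq,
    ae_map_iff (measurePreserving_shear hG w).measurable.aemeasurable hmeas]
  have h0 : ∀ᵐ z : ℝ × V, z.1 ≠ 0 :=
    Measure.quasiMeasurePreserving_fst.ae (Measure.ae_ne volume (0 : ℝ))
  filter_upwards [h0] with z hz
  simpa [shear] using hz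

end

section

variable {ι : Type*} [Fintype ι]

theorem sum_map_single_mul (ℓ : EuclideanSpace ℝ ι →L[ℝ] ℝ) [DecidableEq ι]
    (v : EuclideanSpace ℝ ι) :
    ∑ i, ℓ (EuclideanSpace.single i 1) * v i = ℓ v := by
  conv_rhs => rw [← (EuclideanSpace.basisFun ι ℝ).sum_repr v]
  simp [map_sum, mul_comm]

variable [DecidableEq ι]

theorem LipschitzWith.integral_lineDeriv_eq_zero {V : Type*} [NormedAddCommGroup V]
    [NormedSpace ℝ V] [FiniteDimensional ℝ V] [MeasurableSpace V] [BorelSpace V]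
    {μ : Measure V} [μ.IsAddHaarMeasure] {g : V → ℝ} {D : NNReal}
    (hg : LipschitzWith D g) (hgc : HasCompactSupport g) (v : V) :
    ∫ x, lineDeriv ℝ g x v ∂μ = 0 := by
  have := (LipschitzWith.const (α := V) (1 : ℝ)).integral_lineDeriv_mul_eq (μ := μ) hg hgc (-v)
  simpa [lineDeriv] using this.symm

theorem LipschitzWith.integrable_lineDeriv {V : Type*} [NormedAddCommGroup V]
    [NormedSpace ℝ V] [FiniteDimensional ℝ V] [MeasurableSpace V] [BorelSpace V]
    {μ : Measure V} [μ.IsAddHaarMeasure] {g : V → ℝ} {D : NNReal}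
    (hg : LipschitzWith D g) (hgc : HasCompactSupport g) (v : V) :
    Integrable (fun x => lineDeriv ℝ g x v) μ := by
  rw [← integrableOn_iff_integrable_of_support_subset (s := tsupport g)]
  · exact (hg.locallyIntegrable_lineDeriv v).integrableOn_isCompact hgc
  · intro x hx
    by_contra h
    have h0 : g =ᶠ[nhds x] 0 := notMem_tsupport_iff_eventuallyEq.1 h
    refine hx ?_
    simp only [h0.lineDeriv_eq]
    simp [lineDeriv]

variable {H : ℝ × EuclideanSpace ℝ ι → EuclideanSpace ℝ ι} {G : EuclideanSpace ℝ ι → ℝ}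
  {D : NNReal} {w : EuclideanSpace ℝ ι}

theorem integral_slice_shear (hH : ContDiff ℝ 1 H) (hHc : HasCompactSupport H)
    (hG : LipschitzWith D G) {C : ℝ} (hGC : ∀ y, |G y| ≤ C) (s : ℝ) :
    ∫ y, ((∑ i, fderiv ℝ H (shear G w (s, y)) (0, EuclideanSpace.single i 1) i) +
      fderiv ℝ G y (fderiv ℝ H (shear G w (s, y)) (1, w))) = 0 := by
  obtain ⟨K, hK⟩ := ContDiff.lipschitzWith_of_hasCompactSupport hHc hH one_ne_zero
  have hS : ∃ K', LipschitzWith K' fun y => shear G w (s, y) := by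
    have h1 : LipschitzWith D fun y => s + G y := by
      simpa using (LipschitzWith.const s).add hG
    have h2 : LipschitzWith (1 + ‖w‖₊ * D) fun y => y + (s + G y) • w := by
      refine LipschitzWith.id.add ?_
      refine LipschitzWith.of_dist_le_mul fun x y => ?_
      rw [dist_eq_norm, ← sub_smul, norm_smul, ← dist_eq_norm, mul_comm]
      push_cast
      rw [mul_assoc]
      exact mul_le_mul_of_nonneg_left (h1.dist_le_mul x y) (norm_nonneg _)
    exact ⟨_, h1.prodMk h2⟩
  obtain ⟨K', hK'⟩ := hS
  set ψ : ι → EuclideanSpace ℝ ι → ℝ := fun i y => H (shear G w (s, y)) i with hψ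
  have hψL : ∀ i, ∃ K'', LipschitzWith K'' (ψ i) := fun i =>
    ⟨_, (EuclideanSpace.proj i : EuclideanSpace ℝ ι →L[ℝ] ℝ).lipschitz.comp (hK.comp hK')⟩
  have hψc : ∀ i, HasCompactSupport (ψ i) := by
    intro i
    obtain ⟨ρ, hρ⟩ := hHc.isBounded.subset_closedBall 0
    refine HasCompactSupport.intro (isCompact_closedBall 0 (ρ + (|s| + C) * ‖w‖)) fun y hy => ?_
    have : H (shear G w (s, y)) = 0 := by
      refine image_eq_zero_of_notMem_tsupport fun hmem => hy ?_
      have h1 : ‖y + (s + G y) • w‖ ≤ ρ :=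
        (norm_snd_le (shear G w (s, y))).trans (mem_closedBall_zero_iff.1 (hρ hmem))
      have h2 : ‖(s + G y) • w‖ ≤ (|s| + C) * ‖w‖ := by
        rw [norm_smul]
        exact mul_le_mul_of_nonneg_right ((abs_add_le _ _).trans (by linarith [hGC y]))
          (norm_nonneg _)
      rw [mem_closedBall_zero_iff]
      calc ‖y‖ = ‖y + (s + G y) • w - (s + G y) • w‖ := by simp
        _ ≤ _ := (norm_sub_le _ _).trans (add_le_add h1 h2)
    simp [hψ, this]
  have hae : ∀ᵐ y, (∑ i, fderiv ℝ H (shear G w (s, y)) (0, EuclideanSpace.single i 1) i) +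
      fderiv ℝ G y (fderiv ℝ H (shear G w (s, y)) (1, w)) =
      ∑ i, lineDeriv ℝ (ψ i) y (EuclideanSpace.single i 1) := by
    filter_upwards [hG.ae_differentiableAt] with y hy
    rw [← sum_map_single_mul (fderiv ℝ G y), ← Finset.sum_add_distrib]
    refine Finset.sum_congr rfl fun i _ => ?_
    have hd : HasFDerivAt (fun y => shear G w (s, y))
        ((fderiv ℝ G y).prod (.id ℝ _ + (fderiv ℝ G y).smulRight w)) y := by
      have h1 := hy.hasFDerivAt.const_add s
      exact h1.prodMk ((hasFDerivAt_id y).add (h1.smul_const w))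
    have hd2 := ((hH.differentiable one_ne_zero _).hasFDerivAt).comp y hd
    have hd3 := ((EuclideanSpace.proj i : EuclideanSpace ℝ ι →L[ℝ] ℝ).hasFDerivAt).comp y hd2
    refine Eq.trans ?_ (hd3.hasLineDerivAt (EuclideanSpace.single i 1)).lineDeriv.symm
    set α := fderiv ℝ G y (EuclideanSpace.single i 1) with hα
    have : ((fderiv ℝ G y).prod (.id ℝ _ + (fderiv ℝ G y).smulRight w))
        (EuclideanSpace.single i (1 : ℝ)) = (0, EuclideanSpace.single i 1) + α • (1, w) := by
      simp [hα]
    simp only [ContinuousLinearMap.comp_apply, this, map_add, map_smul]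
    simp
  rw [integral_congr_ae hae, integral_finsetSum]
  · refine Finset.sum_eq_zero fun i _ => ?_
    obtain ⟨K'', hK''⟩ := hψL i
    exact hK''.integral_lineDeriv_eq_zero (hψc i) _
  · intro i _
    obtain ⟨K'', hK''⟩ := hψL i
    exact hK''.integrable_lineDeriv (hψc i) _

theorem continuous_sum_fderiv (hH : ContDiff ℝ 1 H) :
    Continuous fun p => ∑ i, fderiv ℝ H p (0, EuclideanSpace.single i 1) i := by
  have := hH.continuous_fderiv one_ne_zero
  fun_prop

theorem hasCompactSupport_sum_fderiv (hHc : HasCompactSupport H) :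
    HasCompactSupport fun p => ∑ i, fderiv ℝ H p (0, EuclideanSpace.single i 1) i :=
  (hHc.fderiv ℝ).comp_left
    (g := fun A : ℝ × EuclideanSpace ℝ ι →L[ℝ] EuclideanSpace ℝ ι =>
      ∑ i, A (0, EuclideanSpace.single i 1) i) (by simp)

theorem integrable_fderiv_comp_shear (hH : ContDiff ℝ 1 H) (hHc : HasCompactSupport H)
    (hG : LipschitzWith D G) :
    Integrable fun p : ℝ × EuclideanSpace ℝ ι =>
      fderiv ℝ G p.2 (fderiv ℝ H (shear G w p) (1, w)) := by
  have hcont : Continuous fun p => fderiv ℝ H p (1, w) := by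
    have := hH.continuous_fderiv one_ne_zero
    fun_prop
  have hN : Integrable fun p => fderiv ℝ H p (1, w) :=
    hcont.integrable_of_hasCompactSupport ((hHc.fderiv ℝ).comp_left
      (g := fun A : ℝ × EuclideanSpace ℝ ι →L[ℝ] EuclideanSpace ℝ ι => A (1, w)) (by simp))
  have hmp := measurePreserving_shear hG.continuous w
  have hNs : Integrable fun p => fderiv ℝ H (shear G w p) (1, w) :=
    hmp.integrable_comp_of_integrable hN
  refine (hNs.norm.const_mul (D : ℝ)).mono' ?_ (Filter.Eventually.of_forall fun p => ?_)
  · have heq : ∀ p : ℝ × EuclideanSpace ℝ ι, fderiv ℝ G p.2 (fderiv ℝ H (shear G w p) (1, w)) =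
        ∑ i, fderiv ℝ G p.2 (EuclideanSpace.single i 1) * fderiv ℝ H (shear G w p) (1, w) i :=
      fun p => (sum_map_single_mul _ _).symm
    simp only [heq]
    refine (Finset.measurable_fun_sum _ fun i _ => Measurable.mul ?_ ?_).aestronglyMeasurable
    · exact (measurable_fderiv_apply_const ℝ G _).comp measurable_snd
    · have := hcont.measurable.comp hmp.measurable
      exact (EuclideanSpace.proj i : EuclideanSpace ℝ ι →L[ℝ] ℝ).continuous.measurable.comp this
  · exact (ContinuousLinearMap.le_opNorm _ _).trans
      (mul_le_mul_of_nonneg_right (norm_fderiv_le_of_lipschitz ℝ hG) (norm_nonneg _))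

/-- Divergence theorem for the region above a sheared Lipschitz graph, for vector fields with
vanishing last component. -/
theorem setIntegral_sum_fderiv_eq (hH : ContDiff ℝ 1 H) (hHc : HasCompactSupport H)
    (hG : LipschitzWith D G) {C : ℝ} (hGC : ∀ y, |G y| ≤ C) :
    ∫ p in {p : ℝ × EuclideanSpace ℝ ι | G (p.2 - p.1 • w) ≤ p.1},
      ∑ i, fderiv ℝ H p (0, EuclideanSpace.single i 1) i =
    ∫ y, fderiv ℝ G y (H (G y, y + G y • w)) := by
  have hGc := hG.continuous
  have hmp := measurePreserving_shear hGc w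
  set T : ℝ × EuclideanSpace ℝ ι → ℝ :=
    fun p => ∑ i, fderiv ℝ H p (0, EuclideanSpace.single i 1) i with hT
  set M : ℝ × EuclideanSpace ℝ ι → ℝ :=
    fun p => fderiv ℝ G p.2 (fderiv ℝ H (shear G w p) (1, w)) with hM
  have hTint : Integrable T :=
    (continuous_sum_fderiv hH).integrable_of_hasCompactSupport (hasCompactSupport_sum_fderiv hHc)
  have hTs : Integrable fun p => T (shear G w p) := hmp.integrable_comp_of_integrable hTint
  have hMint : Integrable M := integrable_fderiv_comp_shear hH hHc hG
  have hΩ : MeasurableSet {p : ℝ × EuclideanSpace ℝ ι | G (p.2 - p.1 • w) ≤ p.1} :=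
    (isClosed_le (by fun_prop) (by fun_prop)).measurableSet
  have hpre : shear G w ⁻¹' {p : ℝ × EuclideanSpace ℝ ι | G (p.2 - p.1 • w) ≤ p.1} =
      Ici 0 ×ˢ univ := by
    ext p
    simpa using shear_mem_iff G w p
  have hmap : ∫ p in {p : ℝ × EuclideanSpace ℝ ι | G (p.2 - p.1 • w) ≤ p.1}, T p =
      ∫ p in Ici 0 ×ˢ univ, T (shear G w p) := by
    rw [← hpre, ← setIntegral_map hΩ (hmp.map_eq.symm ▸ hTint.aestronglyMeasurable)
      hmp.measurable.aemeasurable, hmp.map_eq]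
  have hslice : ∀ᵐ s : ℝ, ∫ y, T (shear G w (s, y)) = -∫ y, M (s, y) := by
    filter_upwards [hTs.prod_right_ae, hMint.prod_right_ae] with s h1 h2
    have := integral_slice_shear (w := w) hH hHc hG hGC s
    rw [integral_add h1 h2] at this
    linarith
  have hinner : ∀ y, ∫ s in Ici (0 : ℝ), M (s, y) = -fderiv ℝ G y (H (G y, y + G y • w)) := by
    intro y
    set k : ℝ → ℝ := fun s => fderiv ℝ G y (H (shear G w (s, y))) with hk
    have hsh : ContDiff ℝ 1 fun s : ℝ => shear G w (s, y) := by
      simp only [shear]; fun_prop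
    have hkd : ContDiff ℝ 1 k := (fderiv ℝ G y).contDiff.comp (hH.comp hsh)
    have hkc : HasCompactSupport k := by
      obtain ⟨ρ, hρ⟩ := hHc.isBounded.subset_closedBall 0
      refine HasCompactSupport.intro (isCompact_closedBall 0 (ρ + C)) fun s hs => ?_
      have : H (shear G w (s, y)) = 0 := by
        refine image_eq_zero_of_notMem_tsupport fun hmem => hs ?_
        have h1 : ‖s + G y‖ ≤ ρ :=
          (norm_fst_le (shear G w (s, y))).trans (mem_closedBall_zero_iff.1 (hρ hmem))
        rw [mem_closedBall_zero_iff]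
        calc ‖s‖ = ‖s + G y - G y‖ := by simp
          _ ≤ _ := (norm_sub_le _ _).trans (add_le_add h1 (hGC y))
      simp [hk, this]
    have hder : ∀ s, deriv k s = M (s, y) := by
      intro s
      have h1 : HasDerivAt (fun s : ℝ => shear G w (s, y)) (1, w) s := by
        have := (hasDerivAt_id s).add_const (G y)
        simpa [shear] using this.prodMk ((this.smul_const w).const_add y)
      have h2 := (hH.differentiable one_ne_zero (shear G w (s, y))).hasFDerivAt.comp_hasDerivAt s h1
      exact ((fderiv ℝ G y).hasFDerivAt.comp_hasDerivAt s h2).deriv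
    rw [integral_Ici_eq_integral_Ioi]
    simp_rw [← hder]
    rw [hkc.integral_Ioi_deriv_eq hkd]
    simp [hk, shear]
  have hrestr : (volume : Measure (ℝ × EuclideanSpace ℝ ι)).restrict (Ici 0 ×ˢ univ) =
      (volume.restrict (Ici 0)).prod volume := by
    rw [Measure.volume_eq_prod, ← Measure.prod_restrict, Measure.restrict_univ]
  have hTs' := hTs.restrict (s := Ici 0 ×ˢ univ)
  have hM' := hMint.restrict (s := Ici 0 ×ˢ univ)
  rw [hrestr] at hTs' hM'
  rw [hmap, hrestr, integral_prod _ hTs', integral_congr_ae (ae_restrict_of_ae hslice),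
    integral_neg, ← integral_prod _ hM', integral_prod_symm _ hM']
  simp_rw [hinner, integral_neg, neg_neg]

theorem setIntegral_Ici_eq_of_eqOn_one {χ : ℝ → ℝ} (hχ : Integrable χ) {C r : ℝ}
    (h1 : ∀ t, |t| ≤ C → χ t = 1) (hr : |r| ≤ C) :
    ∫ t in Ici r, χ t = C - r + ∫ t in Ioi C, χ t := by
  have hrC := abs_le.1 hr
  rw [integral_Ici_eq_integral_Ioi, ← Ioc_union_Ioi_eq_Ioi hrC.2,
    setIntegral_union (Ioc_disjoint_Ioi le_rfl) measurableSet_Ioi hχ.integrableOn hχ.integrableOn]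
  congr 1
  rw [setIntegral_congr_fun (g := fun _ => (1 : ℝ)) measurableSet_Ioc fun t ht => h1 t
    (abs_le.2 ⟨hrC.1.trans ht.1.le, ht.2⟩)]
  simp [hrC.2]

theorem integral_sum_fderiv_eq_zero {φ : EuclideanSpace ℝ ι → EuclideanSpace ℝ ι}
    (hφ : ContDiff ℝ 1 φ) (hφc : HasCompactSupport φ) :
    ∫ x, ∑ i, fderiv ℝ φ x (EuclideanSpace.single i 1) i = 0 := by
  obtain ⟨K, hK⟩ := ContDiff.lipschitzWith_of_hasCompactSupport hφc hφ one_ne_zero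
  have hL : ∀ i, LipschitzWith _ fun x => φ x i := fun i =>
    (EuclideanSpace.proj i : EuclideanSpace ℝ ι →L[ℝ] ℝ).lipschitz.comp hK
  have hc : ∀ i, HasCompactSupport fun x => φ x i := fun i =>
    hφc.comp_left (g := fun v : EuclideanSpace ℝ ι => v i) rfl
  have heq : ∀ x i, fderiv ℝ φ x (EuclideanSpace.single i 1) i =
      lineDeriv ℝ (fun x => φ x i) x (EuclideanSpace.single i 1) := fun x i =>
    (((EuclideanSpace.proj i : EuclideanSpace ℝ ι →L[ℝ] ℝ).hasFDerivAt.comp x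
      (hφ.differentiable one_ne_zero x).hasFDerivAt).hasLineDerivAt _).lineDeriv.symm
  simp_rw [heq]
  rw [integral_finsetSum _ fun i _ => (hL i).integrable_lineDeriv (hc i) _]
  exact Finset.sum_eq_zero fun i _ => (hL i).integral_lineDeriv_eq_zero (hc i) _

/-- If the epigraph of the bounded function `f` is, up to its boundary, the region above a sheared
Lipschitz graph, then the distributional gradient of `f` is an integral over that graph. -/
theorem integral_mul_sum_fderiv_eq {f : EuclideanSpace ℝ ι → ℝ} {C : ℝ}
    (hf : ∀ x, |f x| < C) (hG : LipschitzWith D G) (hGC : ∀ y, |G y| ≤ C)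
    (hfG : ∀ y t, (G y < t → f (y + t • w) ≤ t) ∧ (t < G y → t < f (y + t • w)))
    {φ : EuclideanSpace ℝ ι → EuclideanSpace ℝ ι}
    (hφ : ContDiff ℝ 1 φ) (hφc : HasCompactSupport φ) :
    ∫ x, f x * ∑ i, fderiv ℝ φ x (EuclideanSpace.single i 1) i =
      -∫ y, fderiv ℝ G y (φ (y + G y • w)) := by
  have hC : 0 < C := (abs_nonneg _).trans_lt (hf 0)
  let χ : ContDiffBump (0 : ℝ) := ⟨C, C + 1, hC, by linarith⟩
  have hχ1 : ∀ t, |t| ≤ C → χ t = 1 := fun t ht =>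
    χ.one_of_mem_closedBall (by simpa [χ] using ht)
  have hχd : ContDiff ℝ 1 χ := χ.contDiff
  set H : ℝ × EuclideanSpace ℝ ι → EuclideanSpace ℝ ι := fun p => χ p.1 • φ p.2 with hHdef
  have hH : ContDiff ℝ 1 H := by fun_prop
  have hHc : HasCompactSupport H := by
    refine HasCompactSupport.intro (χ.hasCompactSupport.isCompact.prod hφc.isCompact) fun p hp => ?_
    by_cases h : p.1 ∈ tsupport χ
    · have : p.2 ∉ tsupport φ := fun h' => hp ⟨h, h'⟩
      simp [hHdef, image_eq_zero_of_notMem_tsupport this]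
    · simp [hHdef, image_eq_zero_of_notMem_tsupport h]
  have hHG : ∀ y, H (G y, y + G y • w) = φ (y + G y • w) := fun y => by
    simp [hHdef, hχ1 _ (hGC y)]
  have key := setIntegral_sum_fderiv_eq (w := w) hH hHc hG hGC
  simp_rw [hHG] at key
  rw [← key]
  set div : EuclideanSpace ℝ ι → ℝ :=
    fun x => ∑ i, fderiv ℝ φ x (EuclideanSpace.single i 1) i with hdiv
  have hT : ∀ t x, ∑ i, fderiv ℝ H (t, x) (0, EuclideanSpace.single i 1) i = χ t * div x := by
    intro t x
    have h1 : ∀ v, fderiv ℝ H (t, x) (0, v) = χ t • fderiv ℝ φ x v := by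
      intro v
      have h2 : HasFDerivAt (fun z => H (t, z)) (χ t • fderiv ℝ φ x) x :=
        (hφ.differentiable one_ne_zero x).hasFDerivAt.const_smul (χ t)
      have h3 := (hH.differentiable one_ne_zero (t, x)).hasFDerivAt.comp x
        (hasFDerivAt_prodMk_right t x)
      have := congrArg (fun A => A v) (h2.unique h3)
      simpa using this.symm
    simp [h1, hdiv, Finset.mul_sum]
  have hΩ : MeasurableSet {p : ℝ × EuclideanSpace ℝ ι | G (p.2 - p.1 • w) ≤ p.1} := by
    have := hG.continuous
    exact (isClosed_le (by fun_prop) (by fun_prop)).measurableSet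
  have hTint : Integrable fun p => ∑ i, fderiv ℝ H p (0, EuclideanSpace.single i 1) i :=
    (continuous_sum_fderiv hH).integrable_of_hasCompactSupport (hasCompactSupport_sum_fderiv hHc)
  have hdivint : Integrable div := by
    have hc := hφ.continuous_fderiv one_ne_zero
    exact Continuous.integrable_of_hasCompactSupport (by fun_prop)
      ((hφc.fderiv ℝ).comp_left
        (g := fun A : EuclideanSpace ℝ ι →L[ℝ] EuclideanSpace ℝ ι =>
          ∑ i, A (EuclideanSpace.single i 1) i) (by simp))
  set κ := ∫ t in Ioi C, χ t
  have hslice : ∀ᵐ x, ∫ t, indicator {p : ℝ × EuclideanSpace ℝ ι | G (p.2 - p.1 • w) ≤ p.1}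
      (fun p => ∑ i, fderiv ℝ H p (0, EuclideanSpace.single i 1) i) (t, x) =
      (C + κ) * div x - f x * div x := by
    filter_upwards [ae_ae_ne_of_continuous hG.continuous w] with x hx
    have : ∀ᵐ t : ℝ, indicator {p : ℝ × EuclideanSpace ℝ ι | G (p.2 - p.1 • w) ≤ p.1}
        (fun p => ∑ i, fderiv ℝ H p (0, EuclideanSpace.single i 1) i) (t, x) =
        indicator (Ici (f x)) χ t * div x := by
      filter_upwards [hx] with t ht
      have h := hfG (x - t • w) t
      rw [sub_add_cancel] at h
      rcases lt_or_gt_of_ne ht with h' | h'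
      · rw [indicator_of_mem (by exact h'.le), indicator_of_mem (by exact h.1 h'), hT]
      · rw [indicator_of_notMem (by exact not_le.2 h'),
          indicator_of_notMem (by exact not_le.2 (h.2 h')), zero_mul]
    rw [integral_congr_ae this, integral_mul_const, integral_indicator measurableSet_Ici,
      setIntegral_Ici_eq_of_eqOn_one
        (hχd.continuous.integrable_of_hasCompactSupport χ.hasCompactSupport) hχ1 (hf x).le]
    ring
  have hind := hTint.indicator hΩ
  have hsub : Integrable fun x => (C + κ) * div x - f x * div x :=
    (integrable_congr hslice).1 hind.integral_prod_right
  have hfint : Integrable fun x => f x * div x := by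
    refine ((hdivint.const_mul (C + κ)).sub hsub).congr (Filter.Eventually.of_forall fun x => ?_)
    simp
  rw [← integral_indicator hΩ, Measure.volume_eq_prod, integral_prod_symm _ hind,
    integral_congr_ae hslice, integral_sub (hdivint.const_mul _) hfint, integral_const_mul,
    integral_sum_fderiv_eq_zero hφ hφc]
  simp [hdiv]

end

section

variable {n : ℕ} {f : EuclideanSpace ℝ (Fin n) → ℝ} {C L : ℝ}
  {u : EuclideanSpace ℝ (Fin n) × ℝ}

theorem exists_mem_frontier_epigraph (hbd : ∀ p, |f p| < C) (x w : EuclideanSpace ℝ (Fin n)) :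
    ∃ t, (x + t • w, t) ∈ frontier {q : EuclideanSpace ℝ (Fin n) × ℝ | f q.1 ≤ q.2} ∧
      |t| ≤ C := by
  have hγ : Continuous fun t : ℝ => (x + t • w, t) := by fun_prop
  obtain ⟨t, ht, htC⟩ := Real.exists_mem_frontier_abs_le
    (T := (fun t : ℝ => (x + t • w, t)) ⁻¹'
      {q : EuclideanSpace ℝ (Fin n) × ℝ | f q.1 ≤ q.2}) (C := C)
    (fun t ht => ((abs_lt.1 (hbd _)).2.le.trans ht : f (x + t • w) ≤ t))
    (fun t ht h => absurd (h : f (x + t • w) ≤ t) (not_le.2 (ht.trans_lt (abs_lt.1 (hbd _)).1)))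
  exact ⟨t, hγ.frontier_preimage_subset _ ht, htC⟩

theorem norm_sq_add_sq_eq_one_of_pNorm_eq_one (hu : pNorm u = 1) : ‖u.1‖ ^ 2 + u.2 ^ 2 = 1 := by
  rwa [pNorm, Real.sqrt_eq_one] at hu

theorem snd_ne_zero_of_frontier_lipschitz (hbd : ∀ p, |f p| < C) (hL : 0 ≤ L) (hu : pNorm u = 1)
    (hLip : ∀ p ∈ frontier {q : EuclideanSpace ℝ (Fin n) × ℝ | f q.1 ≤ q.2},
      ∀ q ∈ frontier {q : EuclideanSpace ℝ (Fin n) × ℝ | f q.1 ≤ q.2},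
        |pInner (q - p) u| ≤ L * pNorm ((q - p) - pInner (q - p) u • u)) : u.2 ≠ 0 := by
  intro h0
  have hu1 := norm_sq_add_sq_eq_one_of_pNorm_eq_one hu
  rw [h0] at hu1
  have hC : 0 < C := (abs_nonneg _).trans_lt (hbd 0)
  set s : ℝ := 2 * L * C + 1 with hs
  obtain ⟨t₀, ht₀, ht₀C⟩ := exists_mem_frontier_epigraph hbd 0 0
  obtain ⟨t₁, ht₁, ht₁C⟩ := exists_mem_frontier_epigraph hbd (s • u.1) 0
  have key := hLip _ ht₀ _ ht₁
  have h1 : pInner ((s • u.1 + t₁ • (0 : EuclideanSpace ℝ (Fin n)), t₁) -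
      ((0 : EuclideanSpace ℝ (Fin n)) + t₀ • (0 : EuclideanSpace ℝ (Fin n)), t₀)) u = s := by
    simp only [pInner, smul_zero, add_zero, Prod.fst_sub, sub_zero, Prod.snd_sub, h0, mul_zero,
      real_inner_smul_left, real_inner_self_eq_norm_sq]
    linear_combination s * hu1
  rw [h1] at key
  have h2 : pNorm ((s • u.1 + t₁ • (0 : EuclideanSpace ℝ (Fin n)), t₁) -
      ((0 : EuclideanSpace ℝ (Fin n)) + t₀ • (0 : EuclideanSpace ℝ (Fin n)), t₀) - s • u) =
      |t₁ - t₀| := by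
    simp [pNorm, h0, Real.sqrt_sq_eq_abs]
  rw [h2, abs_of_nonneg (by positivity)] at key
  have h3 : |t₁ - t₀| ≤ 2 * C := (abs_sub _ _).trans (by linarith)
  nlinarith

/-- The boundary of the epigraph is a graph in the direction `u`, here parametrized by the
hyperplane `ℝⁿ × {0}` and measured by the last coordinate. -/
theorem exists_sheared_graph (hbd : ∀ p, |f p| < C) (hL : 0 ≤ L) (hu : pNorm u = 1)
    (hLip : ∀ p ∈ frontier {q : EuclideanSpace ℝ (Fin n) × ℝ | f q.1 ≤ q.2},
      ∀ q ∈ frontier {q : EuclideanSpace ℝ (Fin n) × ℝ | f q.1 ≤ q.2},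
        |pInner (q - p) u| ≤ L * pNorm ((q - p) - pInner (q - p) u • u)) :
    ∃ G : EuclideanSpace ℝ (Fin n) → ℝ, (∀ y, |G y| ≤ C) ∧
      (∀ y t, (G y < t → f (y + t • u.2⁻¹ • u.1) ≤ t) ∧
        (t < G y → t < f (y + t • u.2⁻¹ • u.1))) ∧
      ∀ x h, (⟪h, u.1⟫ + (G (x + h) - G x) / u.2) ^ 2 ≤ L ^ 2 * (‖h‖ ^ 2 - ⟪h, u.1⟫ ^ 2) := by
  have ha := snd_ne_zero_of_frontier_lipschitz hbd hL hu hLip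
  have hu1 := norm_sq_add_sq_eq_one_of_pNorm_eq_one hu
  obtain ⟨b, a⟩ := u
  simp only at ha hu1 ⊢
  have hbb : ⟪b, b⟫ = 1 - a ^ 2 := by rw [real_inner_self_eq_norm_sq]; linarith
  set w := a⁻¹ • b with hw
  have hin : ∀ x h : EuclideanSpace ℝ (Fin n), ∀ t t' : ℝ,
      (x + t • w, t) ∈ frontier {q : EuclideanSpace ℝ (Fin n) × ℝ | f q.1 ≤ q.2} →
      (x + h + t' • w, t') ∈ frontier {q : EuclideanSpace ℝ (Fin n) × ℝ | f q.1 ≤ q.2} →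
      (⟪h, b⟫ + (t' - t) / a) ^ 2 ≤ L ^ 2 * (‖h‖ ^ 2 - ⟪h, b⟫ ^ 2) := by
    intro x h t t' ht ht'
    have key := hLip _ ht _ ht'
    have hd : (x + h + t' • w, t') - (x + t • w, t) = (h + (t' - t) • w, t' - t) := by
      ext1
      · simp only [Prod.fst_sub]; module
      · rfl
    have hp : pInner (h + (t' - t) • w, t' - t) (b, a) = ⟪h, b⟫ + (t' - t) / a := by
      simp only [pInner, hw, inner_add_left, real_inner_smul_left, hbb]
      field_simp
      ring
    have hperp : (h + (t' - t) • w, t' - t) - (⟪h, b⟫ + (t' - t) / a) • (b, a) =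
        (h - ⟪h, b⟫ • b, -(⟪h, b⟫ * a)) := by
      ext1
      · simp only [Prod.smul_mk, Prod.mk_sub_mk, hw]; module
      · simp only [Prod.smul_mk, Prod.mk_sub_mk, smul_eq_mul]; field_simp; ring
    have hsq : ‖h - ⟪h, b⟫ • b‖ ^ 2 + (-(⟪h, b⟫ * a)) ^ 2 = ‖h‖ ^ 2 - ⟪h, b⟫ ^ 2 := by
      rw [norm_sub_sq_real, real_inner_smul_right, norm_smul, mul_pow, Real.norm_eq_abs, sq_abs]
      linear_combination ⟪h, b⟫ ^ 2 * hu1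
    rw [hd, hp, hperp, pNorm, hsq] at key
    have h0 : 0 ≤ ‖h‖ ^ 2 - ⟪h, b⟫ ^ 2 := by rw [← hsq]; positivity
    have := pow_le_pow_left₀ (abs_nonneg _) key 2
    rwa [sq_abs, mul_pow, Real.sq_sqrt h0] at this
  choose G hGf hGC using fun x => exists_mem_frontier_epigraph hbd x w
  refine ⟨G, hGC, fun y t => ?_, fun x h => hin x h _ _ (hGf x) (hGf (x + h))⟩
  have hγ : Continuous fun t : ℝ => (y + t • w, t) := by fun_prop
  have := Real.mem_and_notMem_of_frontier_subset_singleton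
    (T := (fun t : ℝ => (y + t • w, t)) ⁻¹'
      {q : EuclideanSpace ℝ (Fin n) × ℝ | f q.1 ≤ q.2}) (C := C)
    (fun t ht => ((abs_lt.1 (hbd _)).2.le.trans ht : f (y + t • w) ≤ t))
    (fun t ht h => absurd (h : f (y + t • w) ≤ t) (not_le.2 (ht.trans_lt (abs_lt.1 (hbd _)).1)))
    (g := G y) (fun t ht => ?_) t
  · exact ⟨this.1, fun h => not_le.1 (this.2 h)⟩
  · have h1 := hin y 0 _ _ (hGf y) (by simpa using hγ.frontier_preimage_subset _ ht)
    have h2 : ((t - G y) / a) ^ 2 ≤ 0 := by simpa using h1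
    have h3 : (t - G y) / a = 0 := by nlinarith [sq_nonneg ((t - G y) / a)]
    rcases div_eq_zero_iff.1 h3 with h | h
    · exact sub_eq_zero.1 h
    · exact absurd h ha

end

section

variable {V : Type*} [NormedAddCommGroup V] [InnerProductSpace ℝ V]
  {G : V → ℝ} {a L : ℝ} {b : V}

theorem lipschitzWith_of_sheared_graph (ha : a ≠ 0) (hab : ‖b‖ ^ 2 + a ^ 2 = 1) (hL : 0 ≤ L)
    (hG : ∀ x h, (⟪h, b⟫ + (G (x + h) - G x) / a) ^ 2 ≤ L ^ 2 * (‖h‖ ^ 2 - ⟪h, b⟫ ^ 2)) :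
    LipschitzWith (Real.toNNReal (|a| * (1 + L))) G := by
  refine LipschitzWith.of_dist_le_mul fun y x => ?_
  rw [Real.coe_toNNReal _ (by positivity), dist_eq_norm, dist_eq_norm]
  set h := y - x with hh
  have hy : y = x + h := by simp [hh]
  have hb : ‖b‖ ≤ 1 := by nlinarith [sq_nonneg a, norm_nonneg b]
  have h1 : |⟪h, b⟫ + (G y - G x) / a| ≤ L * ‖h‖ := by
    refine abs_le_of_sq_le_sq ?_ (by positivity)
    rw [mul_pow]
    refine (hy ▸ hG x h).trans (mul_le_mul_of_nonneg_left ?_ (sq_nonneg L))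
    linarith [sq_nonneg ⟪h, b⟫]
  have h2 : |⟪h, b⟫| ≤ ‖h‖ :=
    (abs_real_inner_le_norm h b).trans (mul_le_of_le_one_right (norm_nonneg _) hb)
  have h3 : |(G y - G x) / a| ≤ (1 + L) * ‖h‖ := by
    calc |(G y - G x) / a| = |(⟪h, b⟫ + (G y - G x) / a) - ⟪h, b⟫| := by congr 1; ring
      _ ≤ _ := (abs_sub _ _).trans (by linarith)
  rw [abs_div, div_le_iff₀ (abs_pos.2 ha)] at h3
  rw [Real.norm_eq_abs]
  linarith

theorem norm_fderiv_le_of_sheared_graph [CompleteSpace V] (ha : a ≠ 0)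
    (hab : ‖b‖ ^ 2 + a ^ 2 = 1) {x : V} (hx : DifferentiableAt ℝ G x)
    (hG : ∀ h, (⟪h, b⟫ + (G (x + h) - G x) / a) ^ 2 ≤ L ^ 2 * (‖h‖ ^ 2 - ⟪h, b⟫ ^ 2)) :
    ‖fderiv ℝ G x‖ ≤ |a| * √(1 + L ^ 2) := by
  set p := (InnerProductSpace.toDual ℝ V).symm (fderiv ℝ G x) with hp
  have hpin : ∀ h, ⟪p, h⟫ = fderiv ℝ G x h := fun h => InnerProductSpace.toDual_symm_apply
  rw [← (InnerProductSpace.toDual ℝ V).symm.norm_map]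
  refine norm_le_of_forall_inner_add_sq_le ha hab fun h => ?_
  rw [← hp, hpin]
  have ht := (hx.hasFDerivAt.hasLineDerivAt h).tendsto_slope_zero
  refine le_of_tendsto (((ht.div_const a).const_add ⟪h, b⟫).pow 2) ?_
  filter_upwards [self_mem_nhdsWithin] with t (ht0 : t ≠ 0)
  have := hG (t • h)
  rw [real_inner_smul_left, norm_smul, mul_pow, mul_pow, Real.norm_eq_abs, sq_abs] at this
  have e1 : t * ⟪h, b⟫ + (G (x + t • h) - G x) / a =
      t * (⟪h, b⟫ + t⁻¹ • (G (x + t • h) - G x) / a) := by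
    rw [smul_eq_mul]; field_simp
  rw [e1, mul_pow] at this
  have ht2 : 0 < t ^ 2 := by positivity
  refine le_of_mul_le_mul_left (this.trans_eq ?_) ht2
  ring

theorem norm_sq_sub_inner_sq_le (ha : a ≠ 0) (hab : ‖b‖ ^ 2 + a ^ 2 = 1) (x : V) (t : ℝ) :
    ‖x‖ ^ 2 - ⟪x, b⟫ ^ 2 ≤ ‖x + t • a⁻¹ • b‖ ^ 2 + t ^ 2 := by
  have h : ‖x + t • a⁻¹ • b‖ ^ 2 + t ^ 2 = ‖x‖ ^ 2 + 2 * (t / a) * ⟪x, b⟫ + (t / a) ^ 2 := by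
    rw [norm_add_sq_real, smul_smul, real_inner_smul_right, norm_smul, mul_pow, Real.norm_eq_abs,
      sq_abs, show ‖b‖ ^ 2 = 1 - a ^ 2 by linarith]
    field_simp
    ring
  nlinarith [sq_nonneg (⟪x, b⟫ + t / a)]

end

theorem cone_monotone_TV_bound {n : ℕ}
    (K : Set (EuclideanSpace ℝ (Fin n))) (hKcl : IsClosed K)
    (hKconv : Convex ℝ K) (hKcone : ∀ c : ℝ, 0 < c → ∀ x ∈ K, c • x ∈ K)
    (hKint : (interior K).Nonempty)
    (f : EuclideanSpace ℝ (Fin n) → ℝ)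
    (hmono : ∀ x y, y - x ∈ K → f x ≤ f y)
    (C : ℝ) (hbd : ∀ p, |f p| < C)
    (L : ℝ) (hL : 0 ≤ L)
    (hLip : ∃ u : EuclideanSpace ℝ (Fin n) × ℝ, pNorm u = 1 ∧
      ∀ p ∈ frontier {q : EuclideanSpace ℝ (Fin n) × ℝ | f q.1 ≤ q.2},
      ∀ q ∈ frontier {q : EuclideanSpace ℝ (Fin n) × ℝ | f q.1 ≤ q.2},
        |pInner (q - p) u| ≤ L * pNorm ((q - p) - pInner (q - p) u • u))
    (R : ℝ) (hR : 0 < R) :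
    ∀ φ : EuclideanSpace ℝ (Fin n) → EuclideanSpace ℝ (Fin n),
      ContDiff ℝ 1 φ → HasCompactSupport φ →
      tsupport φ ⊆ ball (0 : EuclideanSpace ℝ (Fin n)) R →
      (∀ x, ‖φ x‖ ≤ 1) →
      ∫ x, f x * (∑ i : Fin n, fderiv ℝ φ x (EuclideanSpace.single i 1) i) ≤
        (volume (ball (0 : EuclideanSpace ℝ (Fin n)) 1)).toReal *
          (Real.sqrt (R ^ 2 + C ^ 2)) ^ n * Real.sqrt (1 + L ^ 2) := by
  intro φ hφ hφc hφR hφ1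
  obtain ⟨⟨b, a⟩, hu, hLip⟩ := hLip
  have ha : a ≠ 0 := snd_ne_zero_of_frontier_lipschitz (u := (b, a)) hbd hL hu hLip
  have hab : ‖b‖ ^ 2 + a ^ 2 = 1 := norm_sq_add_sq_eq_one_of_pNorm_eq_one (u := (b, a)) hu
  obtain ⟨G, hGC, hfG, hG⟩ := exists_sheared_graph (u := (b, a)) hbd hL hu hLip
  have hGL := lipschitzWith_of_sheared_graph ha hab hL hG
  simp only at hfG hG
  rw [integral_mul_sum_fderiv_eq hbd hGL hGC hfG hφ hφc]
  set ρ := √(R ^ 2 + C ^ 2) with hρ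
  have hρ0 : 0 < ρ := Real.sqrt_pos.2 (by positivity)
  have hρ2 : ρ ^ 2 = R ^ 2 + C ^ 2 := Real.sq_sqrt (by positivity)
  set A : Set (EuclideanSpace ℝ (Fin n)) := {x | ‖x‖ ^ 2 - ⟪x, b⟫ ^ 2 < ρ ^ 2} with hA
  have hAm : MeasurableSet A := (isOpen_lt (by fun_prop) (by fun_prop)).measurableSet
  have hvol := volume_setOf_norm_sq_sub_inner_sq_lt ha hab hρ0
  rw [finrank_euclideanSpace_fin] at hvol
  have hAfin : volume A ≠ ⊤ := by
    rw [hvol]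
    exact ENNReal.mul_ne_top ENNReal.ofReal_ne_top measure_ball_lt_top.ne
  have hbound : ∀ᵐ y, ‖fderiv ℝ G y (φ (y + G y • a⁻¹ • b))‖ ≤
      A.indicator (fun _ => |a| * √(1 + L ^ 2)) y := by
    filter_upwards [hGL.ae_differentiableAt] with y hy
    by_cases hyA : y ∈ A
    · rw [indicator_of_mem hyA]
      calc ‖fderiv ℝ G y (φ (y + G y • a⁻¹ • b))‖
          ≤ ‖fderiv ℝ G y‖ * ‖φ (y + G y • a⁻¹ • b)‖ := ContinuousLinearMap.le_opNorm _ _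
        _ ≤ ‖fderiv ℝ G y‖ := mul_le_of_le_one_right (norm_nonneg _) (hφ1 _)
        _ ≤ _ := norm_fderiv_le_of_sheared_graph ha hab hy (hG y)
    · have h0 : φ (y + G y • a⁻¹ • b) = 0 := by
        apply image_eq_zero_of_notMem_tsupport
        intro hmem
        apply hyA
        have h1 : ‖y + G y • a⁻¹ • b‖ < R := mem_ball_zero_iff.1 (hφR hmem)
        have h2 : ‖y + G y • a⁻¹ • b‖ ^ 2 < R ^ 2 := pow_lt_pow_left₀ h1 (norm_nonneg _) two_ne_zero
        have h3 : G y ^ 2 ≤ C ^ 2 := sq_le_sq.2 ((hGC y).trans (le_abs_self C))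
        rw [hA, mem_ofPred_eq, hρ2]
        linarith [norm_sq_sub_inner_sq_le ha hab y (G y)]
      simp [h0, indicator_of_notMem hyA]
  calc -∫ y, fderiv ℝ G y (φ (y + G y • a⁻¹ • b))
      ≤ ‖∫ y, fderiv ℝ G y (φ (y + G y • a⁻¹ • b))‖ := neg_le_abs _
    _ ≤ ∫ y, A.indicator (fun _ => |a| * √(1 + L ^ 2)) y :=
        norm_integral_le_of_norm_le
          ((integrable_indicator_iff hAm).2 (integrableOn_const hAfin)) hbound
    _ = (volume (ball (0 : EuclideanSpace ℝ (Fin n)) 1)).toReal * ρ ^ n * √(1 + L ^ 2) := by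
        rw [integral_indicator hAm, setIntegral_const, Measure.real, hvol, ENNReal.toReal_mul,
          ENNReal.toReal_ofReal (by positivity), smul_eq_mul]
        have := abs_pos.2 ha
        field_simp
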